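/- Let (m_n)_{n≥1} be a sequence of integers with m_n ≥ 2 and m_n → ∞, set μ_n = log m_n and t_n = (3·log n)/(2·μ_n), and assume lim_{n→∞} d(t_n)·μ_n = L exists in [−∞, +∞]. Then lim_{n→∞} ‖Q_{n,m_n}^{⌊{t_n}⌋} − U_n‖_TV = Ψ(e^L), where e^{−∞} = 0, e^{+∞} = ∞, Ψ(0) = 0 and Ψ(∞) = 1. -/

import Mathlib

open Filter MeasureTheory
open scoped BigOperators NNReal ENNReal

noncomputable section

/-- The value of `σ⁻¹` at position `i` (0-indexed), as a natural number; `0` out of range. -/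
def invAt (n : ℕ) (σ : Equiv.Perm (Fin n)) (i : ℕ) : ℕ :=
  if h : i < n then ((σ⁻¹ ⟨i, h⟩ : Fin n) : ℕ) else 0

/-- The number of rising sequences of a permutation: one plus the number of descents
of its inverse. -/
def rSeq (n : ℕ) (σ : Equiv.Perm (Fin n)) : ℕ :=
  1 + ((Finset.range (n - 1)).filter fun i => invAt n σ (i + 1) < invAt n σ i).card

/-- The `m`-shuffle distribution on `S_n`:  `Q_{n,m}(σ) = m^{-n} C(n + m - r(σ), n)`. -/
def Qs (n m : ℕ) (σ : Equiv.Perm (Fin n)) : ℝ :=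
  ((m : ℝ) ^ n)⁻¹ * (Nat.choose (n + m - rSeq n σ) n : ℝ)

/-- The uniform distribution on `S_n`. -/
def Us (n : ℕ) (_ : Equiv.Perm (Fin n)) : ℝ := (n.factorial : ℝ)⁻¹

/-- Total variation distance between two probability distributions on `S_n`. -/
def tv (n : ℕ) (μ ν : Equiv.Perm (Fin n) → ℝ) : ℝ :=
  (1 / 2) * ∑ σ : Equiv.Perm (Fin n), |μ σ - ν σ|

/-- Convolution of two distributions on `S_n`. -/
def convol (n : ℕ) (μ ν : Equiv.Perm (Fin n) → ℝ) : Equiv.Perm (Fin n) → ℝ :=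
  fun σ => ∑ τ : Equiv.Perm (Fin n), μ (σ * τ⁻¹) * ν τ

/-- `k`-fold convolution power; the `0`-th power is the point mass at the identity. -/
def iterConv (n : ℕ) (μ : Equiv.Perm (Fin n) → ℝ) : ℕ → Equiv.Perm (Fin n) → ℝ
  | 0 => fun σ => if σ = 1 then 1 else 0
  | k + 1 => convol n μ (iterConv n μ k)

/-- `Ψ(x) = (2π)^{-1/2} ∫_{-x/(4√3)}^{x/(4√3)} e^{-t²/2} dt`. -/
def Psi (x : ℝ) : ℝ :=
  (Real.sqrt (2 * Real.pi))⁻¹ *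
    ∫ t in (-(x / (4 * Real.sqrt 3)))..(x / (4 * Real.sqrt 3)), Real.exp (-t ^ 2 / 2)

/-- The `p`-shuffle distribution on `S_n` for a probability `p` on the positive integers. -/
def Qp (n : ℕ) (p : ℕ → ℝ) (σ : Equiv.Perm (Fin n)) : ℝ := ∑' m : ℕ, p m * Qs n m σ

/-- `{t}`: the nearest integer to `t` (rounding half up), except `{t} = 1/2` for `0 < t < 1/2`. -/
def curly (t : ℝ) : ℝ := if t < 1 / 2 then 1 / 2 else ((round t : ℤ) : ℝ)

/-- `d(t) = 1/2` for `0 < t < 1/2` and `d(t) = t - {t}` for `t ≥ 1/2`. -/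
def dOf (t : ℝ) : ℝ := if t < 1 / 2 then 1 / 2 else t - ((round t : ℤ) : ℝ)

/-- `Ψ(e^L)` for `L ∈ [-∞, ∞]`, with `Ψ(e^{-∞}) = Ψ(0) = 0` and `Ψ(e^{+∞}) = Ψ(∞) = 1`. -/
def PsiExp (L : EReal) : ℝ :=
  if L = ⊤ then 1 else if L = ⊥ then 0 else Psi (Real.exp L.toReal)


/-- The number of positions `k < i` at which `σ⁻¹` does not descend. -/
def ascCount (n : ℕ) (σ : Equiv.Perm (Fin n)) (i : ℕ) : ℕ :=
  ((Finset.range i).filter fun k => ¬ invAt n σ (k + 1) < invAt n σ k).card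

lemma ascCount_succ (n : ℕ) (σ : Equiv.Perm (Fin n)) (i : ℕ) :
    ascCount n σ (i + 1) =
      ascCount n σ i + if invAt n σ (i + 1) < invAt n σ i then 0 else 1 := by
  unfold ascCount
  rw [Finset.range_add_one, Finset.filter_insert]
  split_ifs with h <;> simp_all

lemma ascCount_mono (n : ℕ) (σ : Equiv.Perm (Fin n)) : Monotone (ascCount n σ) :=
  monotone_nat_of_le_succ fun i => by rw [ascCount_succ]; omega

lemma ascCount_add_rSeq (n : ℕ) (σ : Equiv.Perm (Fin (n + 1))) :
    ascCount (n + 1) σ n + rSeq (n + 1) σ = n + 1 := by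
  have := Finset.card_filter_add_card_filter_not (s := Finset.range n)
    (fun i => invAt (n + 1) σ (i + 1) < invAt (n + 1) σ i)
  rw [Finset.card_range] at this
  unfold ascCount rSeq
  rw [Nat.add_sub_cancel]
  omega

lemma one_le_rSeq (n : ℕ) (σ : Equiv.Perm (Fin n)) : 1 ≤ rSeq n σ := by
  unfold rSeq; omega

lemma rSeq_le (n : ℕ) (σ : Equiv.Perm (Fin (n + 1))) : rSeq (n + 1) σ ≤ n + 1 := by
  have := ascCount_add_rSeq n σ; omega

/-- A word is sorted by `σ⁻¹` iff adding the ascent counts to the rearranged word makes it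
strictly increasing. -/
lemma inv_eq_sort_iff {n a : ℕ} (σ : Equiv.Perm (Fin (n + 1))) (w : Fin (n + 1) → Fin a) :
    Tuple.sort w = σ⁻¹ ↔
      StrictMono fun i : Fin (n + 1) => (w (σ⁻¹ i) : ℕ) + ascCount (n + 1) σ i := by
  rw [eq_comm, Tuple.eq_sort_iff', Fin.strictMono_iff_lt_succ, Fin.strictMono_iff_lt_succ]
  refine forall_congr' fun i => ?_
  have h1 : invAt (n + 1) σ (i + 1) = (σ⁻¹ i.succ : Fin (n + 1)) := by
    unfold invAt; rw [dif_pos (by omega)]; rfl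
  have h2 : invAt (n + 1) σ i = (σ⁻¹ i.castSucc : Fin (n + 1)) := by
    unfold invAt; rw [dif_pos (by omega)]; rfl
  have h3 : (σ⁻¹ i.castSucc : Fin (n + 1)) ≠ σ⁻¹ i.succ := by
    intro h
    exact (Fin.castSucc_lt_succ (i := i)).ne (σ⁻¹.injective h)
  have h4 : (((σ⁻¹).trans (Tuple.graphEquiv₁ w)) i.castSucc <
      ((σ⁻¹).trans (Tuple.graphEquiv₁ w)) i.succ) ↔
      toLex (w (σ⁻¹ i.castSucc), σ⁻¹ i.castSucc) < toLex (w (σ⁻¹ i.succ), σ⁻¹ i.succ) := Iff.rfl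
  rw [h4, Prod.Lex.toLex_lt_toLex, Fin.val_succ, Fin.val_castSucc, ascCount_succ, h1, h2]
  simp only [Fin.lt_def, Fin.ext_iff, ne_eq] at *
  split_ifs <;> omega

lemma card_strictMono (n N : ℕ) :
    Fintype.card {g : Fin n → Fin N // StrictMono g} = N.choose n := by
  have e : {g : Fin n → Fin N // StrictMono g} ≃ (Fin n ↪o Fin N) :=
    { toFun := fun g => OrderEmbedding.ofStrictMono g.1 g.2
      invFun := fun g => ⟨g, g.strictMono⟩
      left_inv := fun g => rfl
      right_inv := fun g => by ext; rfl }
  rw [← Nat.card_eq_fintype_card, Nat.card_congr (e.trans Set.powersetCard.ofFinEmbEquiv),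
    Set.powersetCard.card, Nat.card_fin]

/-- The number of words over an alphabet of size `a` sorted by `σ⁻¹`. -/
lemma card_sort_eq (n a : ℕ) (σ : Equiv.Perm (Fin (n + 1))) :
    Fintype.card {w : Fin (n + 1) → Fin a // Tuple.sort w = σ⁻¹} =
      (n + 1 + a - rSeq (n + 1) σ).choose (n + 1) := by
  rw [← card_strictMono]
  have hr := ascCount_add_rSeq n σ
  have hle : ∀ i : Fin (n + 1), ascCount (n + 1) σ i ≤ ascCount (n + 1) σ n := fun i =>
    ascCount_mono _ _ (by omega)
  refine Fintype.card_of_bijective (f := fun w => ⟨fun i =>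
    ⟨(w.1 (σ⁻¹ i) : ℕ) + ascCount (n + 1) σ i, ?_⟩, ?_⟩) ⟨?_, ?_⟩
  · have := hle i
    have := (w.1 (σ⁻¹ i)).2
    omega
  · intro i j hij
    exact (inv_eq_sort_iff σ w.1).1 w.2 hij
  · intro w v h
    ext i
    have := congrArg Fin.val (congrFun (congrArg Subtype.val h) (σ i))
    simpa using this
  · intro g
    have hstep : Monotone fun i : Fin (n + 1) => (g.1 i : ℤ) - ascCount (n + 1) σ i := by
      rw [Fin.monotone_iff_le_succ]
      intro i
      have h1 : (g.1 i.castSucc : ℕ) < g.1 i.succ := g.2 Fin.castSucc_lt_succ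
      have h2 := ascCount_succ (n + 1) σ i
      simp only [Fin.val_succ, Fin.val_castSucc]
      split_ifs at h2 <;> omega
    have hge : ∀ i : Fin (n + 1), ascCount (n + 1) σ i ≤ g.1 i := fun i => by
      have h1 := hstep (Fin.zero_le i)
      have h2 : ascCount (n + 1) σ (0 : Fin (n + 1)) = 0 := by simp [ascCount]
      simp only [h2] at h1
      omega
    have hlt : ∀ i : Fin (n + 1), (g.1 i : ℕ) - ascCount (n + 1) σ i < a := fun i => by
      have h1 := hstep (Fin.le_last i)
      have h2 := hge i
      have h3 := (g.1 (Fin.last n)).2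
      simp only [Fin.val_last] at h1
      omega
    have key : ∀ i : Fin (n + 1), (g.1 i : ℕ) - ascCount (n + 1) σ i + ascCount (n + 1) σ i = g.1 i :=
      fun i => Nat.sub_add_cancel (hge i)
    refine ⟨⟨fun i => ⟨(g.1 (σ i) : ℕ) - ascCount (n + 1) σ (σ i), hlt _⟩, ?_⟩, ?_⟩
    · rw [inv_eq_sort_iff]
      intro i j hij
      have := g.2 hij
      simpa [key] using this
    · ext i
      simp [key]

lemma Qs_eq_card (n a : ℕ) (σ : Equiv.Perm (Fin (n + 1))) :
    Qs (n + 1) a σ = ((a : ℝ) ^ (n + 1))⁻¹ *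
      (Fintype.card {w : Fin (n + 1) → Fin a // Tuple.sort w = σ⁻¹} : ℝ) := by
  rw [card_sort_eq]; rfl

/-- Worpitzky's identity. -/
lemma sum_choose_rSeq (n a : ℕ) :
    ∑ σ : Equiv.Perm (Fin (n + 1)), (n + 1 + a - rSeq (n + 1) σ).choose (n + 1) =
      a ^ (n + 1) := by
  simp_rw [← card_sort_eq]
  rw [← Fintype.card_sigma]
  have e : (Σ σ : Equiv.Perm (Fin (n + 1)),
      {w : Fin (n + 1) → Fin a // Tuple.sort w = σ⁻¹}) ≃ (Fin (n + 1) → Fin a) :=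
    { toFun := fun p => p.2.1
      invFun := fun w => ⟨(Tuple.sort w)⁻¹, w, (inv_inv _).symm⟩
      left_inv := by
        rintro ⟨σ, w, h⟩
        obtain rfl : σ = (Tuple.sort w)⁻¹ := by rw [h, inv_inv]
        rfl
      right_inv := fun w => rfl }
  rw [Fintype.card_congr e]
  simp

/-- Radix sort: sorting lexicographic pairs is sorting by the minor key, then stably by the major
key. -/
lemma sort_lex {n a b : ℕ} (x : Fin n → Fin a) (y : Fin n → Fin b) :
    Tuple.sort (fun i => finProdFinEquiv (x i, y i)) =
      Tuple.sort y * Tuple.sort (x ∘ Tuple.sort y) := by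
  symm
  set ρ := Tuple.sort y with hρ
  set ρ' := Tuple.sort (x ∘ ρ) with hρ'
  obtain ⟨m1, t1⟩ := Tuple.eq_sort_iff.1 hρ
  obtain ⟨m2, t2⟩ := Tuple.eq_sort_iff.1 hρ'
  have hlex : ∀ p q : Fin a × Fin b, p.1 < q.1 ∨ (p.1 = q.1 ∧ p.2 ≤ q.2) →
      finProdFinEquiv p ≤ finProdFinEquiv q := by
    rintro ⟨p1, p2⟩ ⟨q1, q2⟩ h
    simp only [Fin.le_def, Fin.lt_def, Fin.ext_iff, finProdFinEquiv, Equiv.coe_fn_mk] at *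
    rcases h with h | ⟨h, h'⟩
    · have : b * (p1 + 1) ≤ b * (q1 : ℕ) := Nat.mul_le_mul_left _ h
      have := p2.2
      rw [Nat.mul_add] at *
      omega
    · rw [h]; omega
  have hx : ∀ i j, i < j → x (ρ (ρ' i)) = x (ρ (ρ' j)) → ρ' i < ρ' j := t2
  rw [Tuple.eq_sort_iff]
  refine ⟨monotone_iff_forall_lt.2 fun i j hij => hlex _ _ ?_, fun i j hij h => ?_⟩
  · rcases (m2 hij.le).lt_or_eq with h | h
    · exact Or.inl h
    · exact Or.inr ⟨h, m1 (hx i j hij h).le⟩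
  · have h' := finProdFinEquiv.injective h
    simp only [Prod.mk.injEq] at h'
    exact t1 _ _ (hx i j hij h'.1) h'.2

lemma sum_card_mul_card (n a b : ℕ) (σ : Equiv.Perm (Fin n)) :
    ∑ τ : Equiv.Perm (Fin n),
      Fintype.card {u : Fin n → Fin a // Tuple.sort u = (σ * τ⁻¹)⁻¹} *
        Fintype.card {v : Fin n → Fin b // Tuple.sort v = τ⁻¹} =
      Fintype.card {w : Fin n → Fin (a * b) // Tuple.sort w = σ⁻¹} := by
  simp_rw [← Fintype.card_prod]
  rw [← Fintype.card_sigma]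
  refine Fintype.card_of_bijective (f := fun p => ⟨fun i =>
    finProdFinEquiv (p.2.1.1 (p.1 i), p.2.2.1 i), ?_⟩) ⟨?_, ?_⟩
  · obtain ⟨τ, ⟨u, hu⟩, ⟨v, hv⟩⟩ := p
    change Tuple.sort (fun i => finProdFinEquiv ((u ∘ τ) i, v i)) = σ⁻¹
    have : (u ∘ τ) ∘ (τ⁻¹ : Equiv.Perm (Fin n)) = u := by ext i; simp
    rw [sort_lex, hv, this, hu]
    group
  · rintro ⟨τ, ⟨u, hu⟩, ⟨v, hv⟩⟩ ⟨τ', ⟨u', hu'⟩, ⟨v', hv'⟩⟩ h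
    have h' : ∀ i, u (τ i) = u' (τ' i) ∧ v i = v' i := fun i => by
      have := finProdFinEquiv.injective (congrFun (congrArg Subtype.val h) i)
      simpa using this
    obtain rfl : v = v' := funext fun i => (h' i).2
    obtain rfl : τ = τ' := inv_injective (hv.symm.trans hv')
    obtain rfl : u = u' := funext fun i => by simpa using (h' (τ⁻¹ i)).1
    rfl
  · rintro ⟨w, hw⟩
    set x : Fin n → Fin a := fun i => (finProdFinEquiv.symm (w i)).1
    set y : Fin n → Fin b := fun i => (finProdFinEquiv.symm (w i)).2
    have hxy : w = fun i => finProdFinEquiv (x i, y i) := by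
      ext i; simp [x, y, Nat.mod_add_div]
    refine ⟨⟨(Tuple.sort y)⁻¹, ⟨x ∘ Tuple.sort y, ?_⟩, ⟨y, (inv_inv _).symm⟩⟩, ?_⟩
    · rw [hxy, sort_lex] at hw
      rw [mul_inv_rev, ← hw]
      group
    · apply Subtype.ext
      ext i
      simp [x, y, Nat.mod_add_div]

/-- Composing an `a`-shuffle with a `b`-shuffle gives an `ab`-shuffle. -/
lemma convol_Qs (n a b : ℕ) :
    convol (n + 1) (Qs (n + 1) a) (Qs (n + 1) b) = Qs (n + 1) (a * b) := by
  ext σ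
  unfold convol
  simp_rw [Qs_eq_card]
  rw [← sum_card_mul_card n.succ a b σ]
  push_cast
  rw [Finset.mul_sum]
  refine Finset.sum_congr rfl fun τ _ => ?_
  rw [mul_pow, mul_inv]
  ring

lemma iterConv_Qs (n a k : ℕ) :
    iterConv (n + 1) (Qs (n + 1) a) k = Qs (n + 1) (a ^ k) := by
  induction k with
  | zero =>
    ext σ
    rw [pow_zero, Qs_eq_card]
    have h : ∀ w : Fin (n + 1) → Fin 1, Tuple.sort w = 1 := fun w =>
      Tuple.sort_eq_refl_iff_monotone.2 fun i j _ => (Subsingleton.elim _ _).le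
    by_cases hσ : σ = 1 <;> simp [iterConv, h, hσ, eq_comm]
  | succ k ih => rw [iterConv, ih, convol_Qs, pow_succ']

lemma exists_one_add_eq_exp {z : ℂ} (hz : ‖z‖ ≤ 1 / 2) :
    ∃ e : ℂ, 1 + z = Complex.exp (z - z ^ 2 / 2 + e) ∧ ‖e‖ ≤ ‖z‖ ^ 3 := by
  have hz1 : ‖z‖ < 1 := by linarith
  have h1 := Complex.norm_log_sub_logTaylor_le 2 hz1
  have h2 : Complex.logTaylor (2 + 1) z = z - z ^ 2 / 2 := by
    simp [Complex.logTaylor_succ, Complex.logTaylor_zero]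
    ring
  rw [h2] at h1
  have hne : 1 + z ≠ 0 := by
    intro h
    have : z = -1 := by linear_combination h
    rw [this] at hz1
    simp at hz1
  refine ⟨Complex.log (1 + z) - (z - z ^ 2 / 2), ?_, h1.trans ?_⟩
  · rw [add_sub_cancel, Complex.exp_log hne]
  · have h3 : (1 - ‖z‖)⁻¹ ≤ 2 := by
      rw [inv_le_comm₀ (by linarith) (by norm_num)]
      linarith
    have h4 : 0 ≤ ‖z‖ ^ 3 := by positivity
    norm_num
    nlinarith

lemma sum_shift (n : ℕ) (r : ℝ) :
    ∑ j ∈ Finset.range n, ((j : ℝ) + 1 - r) = n * ((n + 1) / 2 - r) := by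
  induction n with
  | zero => simp
  | succ n ih => rw [Finset.sum_range_succ, ih]; push_cast; ring

lemma sum_shift_sq (n : ℕ) (r : ℝ) :
    ∑ j ∈ Finset.range n, ((j : ℝ) + 1 - r) ^ 2 =
      n * ((n ^ 2 - 1) / 12 + ((n + 1) / 2 - r) ^ 2) := by
  induction n with
  | zero => simp
  | succ n ih =>
    have h : ∀ k : ℕ, (k : ℝ) * ((k ^ 2 - 1) / 12 + ((k + 1) / 2 - r) ^ 2) =
        k * (k + 1) * (2 * k + 1) / 6 - k * (k + 1) * r + k * r ^ 2 := fun k => by ring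
    rw [Finset.sum_range_succ, ih, h, h]
    push_cast
    ring

/-- The centred and normalized number of rising sequences `r`. -/
def normRise (n : ℕ) (r : ℝ) : ℝ := √12 * ((n + 1) / 2 - r) / √n

lemma sq_normRise_le {n : ℕ} {r : ℝ} (hr : 1 ≤ r) (hr' : r ≤ n) :
    normRise n r ^ 2 ≤ 3 * n := by
  have hn : (0 : ℝ) < n := by linarith
  unfold normRise
  rw [div_pow, mul_pow, Real.sq_sqrt (by norm_num), Real.sq_sqrt hn.le, div_le_iff₀ hn]
  nlinarith

/-- Gaussian approximation of the generating product of the shuffle densities. -/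
lemma exists_prod_eq_exp {n : ℕ} {r : ℝ} (hr : 1 ≤ r) (hr' : r ≤ n) {s : ℂ}
    (hs : √12 * ‖s‖ / √n ≤ 1 / 2) :
    ∃ η : ℂ, ∏ j ∈ Finset.range n,
        (1 + ((((j : ℝ) + 1 - r : ℝ)) : ℂ) * ((√12 : ℝ) * s / ((n * √n : ℝ) : ℂ))) =
      Complex.exp (s * (normRise n r : ℝ) - s ^ 2 / 2 + η) ∧
      ‖η‖ ≤ ‖s‖ ^ 2 * (1 + normRise n r ^ 2) / n + 42 * ‖s‖ ^ 3 / √n := by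
  have hn : (0 : ℝ) < n := by linarith
  have hsn : 0 < √(n : ℝ) := Real.sqrt_pos.2 hn
  have hsq : √(n : ℝ) ^ 2 = n := Real.sq_sqrt hn.le
  have h12 : √(12 : ℝ) ^ 2 = 12 := Real.sq_sqrt (by norm_num)
  set w : ℂ := (√12 : ℝ) * s / ((n * √n : ℝ) : ℂ) with hw
  have hwn : ‖w‖ = √12 * ‖s‖ / (n * √n) := by
    rw [hw, norm_div, norm_mul, Complex.norm_real, Complex.norm_real,
      Real.norm_of_nonneg (by positivity), Real.norm_of_nonneg (by positivity)]
  have hx : ∀ j ∈ Finset.range n,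
      ‖((((j : ℝ) + 1 - r : ℝ)) : ℂ) * w‖ ≤ √12 * ‖s‖ / √n := fun j hj => by
    have hj' : (j : ℝ) + 1 ≤ n := by exact_mod_cast Finset.mem_range.1 hj
    have hj0 : (0 : ℝ) ≤ j := Nat.cast_nonneg j
    rw [norm_mul, Complex.norm_real, Real.norm_eq_abs, hwn]
    calc |(j : ℝ) + 1 - r| * (√12 * ‖s‖ / (n * √n)) ≤ n * (√12 * ‖s‖ / (n * √n)) := by
          gcongr
          rw [abs_le]; constructor <;> linarith
      _ = √12 * ‖s‖ / √n := by field_simp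
  choose! e he1 he2 using fun j (hj : j ∈ Finset.range n) =>
    exists_one_add_eq_exp ((hx j hj).trans hs)
  refine ⟨s ^ 2 / (2 * (n : ℂ) ^ 2) - s ^ 2 * (normRise n r : ℝ) ^ 2 / (2 * n) +
    ∑ j ∈ Finset.range n, e j, ?_, ?_⟩
  · rw [Finset.prod_congr rfl he1, ← Complex.exp_sum]
    congr 1
    rw [Finset.sum_add_distrib, Finset.sum_sub_distrib, ← Finset.sum_mul]
    simp_rw [mul_pow]
    rw [← Finset.sum_div, ← Finset.sum_mul]
    have e1 : (∑ j ∈ Finset.range n, ((((j : ℝ) + 1 - r : ℝ)) : ℂ)) =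
        ((n * ((n + 1) / 2 - r) : ℝ) : ℂ) := by
      rw [← sum_shift, Complex.ofReal_sum]
    have e2 : (∑ j ∈ Finset.range n, ((((j : ℝ) + 1 - r : ℝ)) : ℂ) ^ 2) =
        ((n * ((n ^ 2 - 1) / 12 + ((n + 1) / 2 - r) ^ 2) : ℝ) : ℂ) := by
      rw [← sum_shift_sq, Complex.ofReal_sum]
      simp
    rw [e1, e2]
    have hnC : (n : ℂ) ≠ 0 := by exact_mod_cast hn.ne'
    have hsC : ((√(n : ℝ) : ℝ) : ℂ) ≠ 0 := by exact_mod_cast hsn.ne'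
    have hsqC : ((√(n : ℝ) : ℝ) : ℂ) ^ 2 = n := by exact_mod_cast hsq
    have h12C : ((√(12 : ℝ) : ℝ) : ℂ) ^ 2 = 12 := by exact_mod_cast h12
    rw [hw, normRise]
    push_cast
    rw [div_pow, div_pow, mul_pow, mul_pow, mul_pow, hsqC, h12C]
    field_simp
    ring
  · have hc : ‖∑ j ∈ Finset.range n, e j‖ ≤ 42 * ‖s‖ ^ 3 / √n := by
      calc ‖∑ j ∈ Finset.range n, e j‖ ≤ ∑ j ∈ Finset.range n, (√12 * ‖s‖ / √n) ^ 3 :=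
            norm_sum_le_of_le _ fun j hj => (he2 j hj).trans (by gcongr; exact hx j hj)
        _ = 12 * √12 * ‖s‖ ^ 3 / √n := by
            rw [Finset.sum_const, Finset.card_range, nsmul_eq_mul, div_pow, mul_pow,
              pow_succ √12 2, h12, pow_succ √(n : ℝ) 2, hsq]
            field_simp
        _ ≤ 42 * ‖s‖ ^ 3 / √n := by
            gcongr
            have : √12 ≤ 3.5 := by
              rw [Real.sqrt_le_left (by norm_num)]; norm_num
            linarith
    have ha : ‖s ^ 2 / (2 * (n : ℂ) ^ 2)‖ ≤ ‖s‖ ^ 2 / n := by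
      have h1n : (1 : ℝ) ≤ n := hr.trans hr'
      simp only [norm_div, norm_mul, norm_pow, Complex.norm_ofNat, Complex.norm_natCast]
      gcongr
      nlinarith
    have hb : ‖s ^ 2 * ((normRise n r : ℝ) : ℂ) ^ 2 / (2 * n)‖ ≤
        ‖s‖ ^ 2 * normRise n r ^ 2 / n := by
      simp only [norm_div, norm_mul, norm_pow, Complex.norm_ofNat, Complex.norm_natCast,
        Complex.norm_real, Real.norm_eq_abs, sq_abs]
      gcongr
      linarith
    calc _ ≤ ‖s‖ ^ 2 / n + ‖s‖ ^ 2 * normRise n r ^ 2 / n + 42 * ‖s‖ ^ 3 / √n :=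
          (norm_add_le _ _).trans (add_le_add ((norm_sub_le _ _).trans (add_le_add ha hb)) hc)
      _ = _ := by ring

lemma exists_prod_eq_exp_real {n : ℕ} {r : ℝ} (hr : 1 ≤ r) (hr' : r ≤ n) {s : ℝ}
    (hs : √12 * |s| / √n ≤ 1 / 2) :
    ∃ η : ℝ, ∏ j ∈ Finset.range n, (1 + ((j : ℝ) + 1 - r) * (√12 * s / (n * √n))) =
      Real.exp (s * normRise n r - s ^ 2 / 2 + η) ∧
      |η| ≤ |s| ^ 2 * (1 + normRise n r ^ 2) / n + 42 * |s| ^ 3 / √n := by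
  have hn : (0 : ℝ) < n := by linarith
  obtain ⟨η, h1, h2⟩ := exists_prod_eq_exp hr hr' (s := s) (by simpa using hs)
  refine ⟨η.re, ?_, (Complex.abs_re_le_norm η).trans (by simpa using h2)⟩
  have hpos : 0 ≤ ∏ j ∈ Finset.range n, (1 + ((j : ℝ) + 1 - r) * (√12 * s / (n * √n))) := by
    refine Finset.prod_nonneg fun j hj => ?_
    have hj' : (j : ℝ) + 1 ≤ n := by exact_mod_cast Finset.mem_range.1 hj
    have hj0 : (0 : ℝ) ≤ j := Nat.cast_nonneg j
    have : |((j : ℝ) + 1 - r) * (√12 * s / (n * √n))| ≤ 1 / 2 := by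
      rw [abs_mul, abs_div, abs_mul, abs_of_nonneg (Real.sqrt_nonneg 12),
        abs_of_nonneg (by positivity : 0 ≤ n * √(n : ℝ))]
      calc |(j : ℝ) + 1 - r| * (√12 * |s| / (n * √n)) ≤ n * (√12 * |s| / (n * √n)) := by
            gcongr
            rw [abs_le]; constructor <;> linarith
        _ = √12 * |s| / √n := by field_simp
        _ ≤ 1 / 2 := hs
    have := (abs_le.1 this).1
    linarith
  have h3 := congrArg (fun z : ℂ => ‖z‖) h1
  simp only [Complex.norm_exp] at h3
  have h4 : (∏ j ∈ Finset.range n,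
        (1 + ((((j : ℝ) + 1 - r : ℝ)) : ℂ) * ((√12 : ℝ) * s / ((n * √n : ℝ) : ℂ)))) =
      ((∏ j ∈ Finset.range n, (1 + ((j : ℝ) + 1 - r) * (√12 * s / (n * √n))) : ℝ) : ℂ) := by
    push_cast; rfl
  have h5 : ((s : ℂ) * (normRise n r : ℝ) - (s : ℂ) ^ 2 / 2 + η).re =
      s * normRise n r - s ^ 2 / 2 + η.re := by
    have : (s : ℂ) * (normRise n r : ℝ) - (s : ℂ) ^ 2 / 2 + η =
      ((s * normRise n r - s ^ 2 / 2 : ℝ) : ℂ) + η := by push_cast; ring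
    rw [this, Complex.add_re, Complex.ofReal_re]
  rw [h4, h5, Complex.norm_real, Real.norm_of_nonneg hpos] at h3
  exact h3

lemma factorial_mul_choose {n r : ℕ} (a : ℕ) (hr : r ≤ n) :
    (n.factorial : ℂ) * ((n + a - r).choose n : ℂ) =
      ∏ j ∈ Finset.range n, ((a : ℂ) + (((j : ℝ) + 1 - r : ℝ) : ℂ)) := by
  rw [← Nat.cast_mul, ← Nat.descFactorial_eq_factorial_mul_choose,
    ← descPochhammer_eval_eq_descFactorial, descPochhammer_eval_eq_prod_range,
    ← Finset.prod_range_reflect]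
  refine Finset.prod_congr rfl fun j hj => ?_
  have := Finset.mem_range.1 hj
  rw [Nat.cast_sub (by omega), Nat.cast_sub (by omega), Nat.cast_sub (by omega)]
  push_cast
  ring

lemma sum_prod_add (n : ℕ) (z : ℂ) :
    ∑ σ : Equiv.Perm (Fin (n + 1)), ∏ j ∈ Finset.range (n + 1),
        (z + (((j : ℝ) + 1 - rSeq (n + 1) σ : ℝ) : ℂ)) = (n + 1).factorial * z ^ (n + 1) := by
  have h := Polynomial.eq_of_infinite_eval_eq
    (∑ σ : Equiv.Perm (Fin (n + 1)), ∏ j ∈ Finset.range (n + 1),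
      (Polynomial.X + Polynomial.C (((j : ℝ) + 1 - rSeq (n + 1) σ : ℝ) : ℂ)))
    (Polynomial.C ((n + 1).factorial : ℂ) * Polynomial.X ^ (n + 1))
    ((Set.infinite_range_of_injective (Nat.cast_injective (R := ℂ))).mono ?_)
  · have := congrArg (Polynomial.eval z) h
    simpa only [Polynomial.eval_finsetSum, Polynomial.eval_prod, Polynomial.eval_add,
      Polynomial.eval_X, Polynomial.eval_C, Polynomial.eval_mul, Polynomial.eval_pow] using this
  · rintro _ ⟨a, rfl⟩
    simp only [Set.mem_ofPred_eq, Polynomial.eval_finsetSum, Polynomial.eval_prod,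
      Polynomial.eval_add, Polynomial.eval_X, Polynomial.eval_C, Polynomial.eval_mul,
      Polynomial.eval_pow]
    simp_rw [← factorial_mul_choose a (rSeq_le n _)]
    rw [← Finset.mul_sum]
    congr 1
    exact_mod_cast sum_choose_rSeq n a

/-- The average of a function on the symmetric group. -/
def permAvg {E : Type*} [DivisionRing E] (n : ℕ) (F : Equiv.Perm (Fin n) → E) : E :=
  (n.factorial : E)⁻¹ * ∑ σ, F σ

lemma permAvg_prod {n : ℕ} (hn : n ≠ 0) (w : ℂ) :
    permAvg n (fun σ => ∏ j ∈ Finset.range n,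
      (1 + (((j : ℝ) + 1 - rSeq n σ : ℝ) : ℂ) * w)) = 1 := by
  obtain ⟨n, rfl⟩ := Nat.exists_eq_succ_of_ne_zero hn
  have hf : (((n + 1).factorial : ℕ) : ℂ) ≠ 0 := by exact_mod_cast Nat.factorial_ne_zero _
  unfold permAvg
  rcases eq_or_ne w 0 with rfl | hw
  · simp [Fintype.card_perm, hf]
  · have h := sum_prod_add n w⁻¹
    have h2 : ∀ σ : Equiv.Perm (Fin (n + 1)), ∏ j ∈ Finset.range (n + 1),
        (1 + (((j : ℝ) + 1 - rSeq (n + 1) σ : ℝ) : ℂ) * w) =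
        w ^ (n + 1) * ∏ j ∈ Finset.range (n + 1),
          (w⁻¹ + (((j : ℝ) + 1 - rSeq (n + 1) σ : ℝ) : ℂ)) := fun σ => by
      rw [Finset.pow_eq_prod_const, ← Finset.prod_mul_distrib]
      refine Finset.prod_congr rfl fun j _ => ?_
      field_simp
    simp only [Nat.succ_eq_add_one]
    simp_rw [h2]
    rw [← Finset.mul_sum, h, mul_left_comm (w ^ (n + 1)), inv_mul_cancel_left₀ hf, ← mul_pow,
      mul_inv_cancel₀ hw, one_pow]

lemma permAvg_prod_real {n : ℕ} (hn : n ≠ 0) (w : ℝ) :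
    permAvg n (fun σ => ∏ j ∈ Finset.range n, (1 + ((j : ℝ) + 1 - rSeq n σ) * w)) = 1 := by
  have h := permAvg_prod hn (w : ℂ)
  unfold permAvg at *
  rw [← Complex.ofReal_inj, Complex.ofReal_one, ← h]
  push_cast
  rfl

lemma permAvg_mono {n : ℕ} {F G : Equiv.Perm (Fin n) → ℝ} (h : ∀ σ, F σ ≤ G σ) :
    permAvg n F ≤ permAvg n G :=
  mul_le_mul_of_nonneg_left (Finset.sum_le_sum fun σ _ => h σ) (by positivity)

lemma permAvg_add {n : ℕ} (F G : Equiv.Perm (Fin n) → ℝ) :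
    permAvg n (fun σ => F σ + G σ) = permAvg n F + permAvg n G := by
  unfold permAvg; rw [Finset.sum_add_distrib, mul_add]

lemma permAvg_sub {E : Type*} [DivisionRing E] {n : ℕ} (F G : Equiv.Perm (Fin n) → E) :
    permAvg n (fun σ => F σ - G σ) = permAvg n F - permAvg n G := by
  unfold permAvg; rw [Finset.sum_sub_distrib, mul_sub]

lemma permAvg_const_mul {E : Type*} [Field E] {n : ℕ} (c : E) (F : Equiv.Perm (Fin n) → E) :
    permAvg n (fun σ => c * F σ) = c * permAvg n F := by
  unfold permAvg; rw [← Finset.mul_sum]; ring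

lemma permAvg_const (n : ℕ) (c : ℝ) : permAvg n (fun _ => c) = c := by
  have hf : ((n.factorial : ℕ) : ℝ) ≠ 0 := by exact_mod_cast Nat.factorial_ne_zero _
  unfold permAvg
  simp [Fintype.card_perm]
  field_simp

lemma norm_permAvg_le {n : ℕ} (F : Equiv.Perm (Fin n) → ℂ) :
    ‖permAvg n F‖ ≤ permAvg n (fun σ => ‖F σ‖) := by
  unfold permAvg
  rw [norm_mul, norm_inv, Complex.norm_natCast]
  gcongr
  exact norm_sum_le _ _

lemma abs_permAvg_le {n : ℕ} (F : Equiv.Perm (Fin n) → ℝ) :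
    |permAvg n F| ≤ permAvg n (fun σ => |F σ|) := by
  unfold permAvg
  rw [abs_mul, abs_of_nonneg (by positivity : (0 : ℝ) ≤ (n.factorial : ℝ)⁻¹)]
  gcongr
  exact Finset.abs_sum_le_sum_abs _ _

/-- The normalized number of rising sequences of a permutation. -/
def permRise (n : ℕ) (σ : Equiv.Perm (Fin n)) : ℝ := normRise n (rSeq n σ)

lemma one_le_rSeq_real (n : ℕ) (σ : Equiv.Perm (Fin n)) : (1 : ℝ) ≤ rSeq n σ := by
  exact_mod_cast one_le_rSeq n σ

lemma rSeq_le_real {n : ℕ} (hn : n ≠ 0) (σ : Equiv.Perm (Fin n)) : (rSeq n σ : ℝ) ≤ n := by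
  obtain ⟨n, rfl⟩ := Nat.exists_eq_succ_of_ne_zero hn
  exact_mod_cast rSeq_le n σ

lemma sqrt_twelve_div_le {n : ℕ} (hn : 48 ≤ n) : √12 / √(n : ℝ) ≤ 1 / 2 := by
  have hn' : (48 : ℝ) ≤ n := by exact_mod_cast hn
  rw [← Real.sqrt_div' _ (by positivity), Real.sqrt_le_left (by norm_num),
    div_le_iff₀ (by linarith)]
  linarith

lemma permAvg_exp_le {n : ℕ} (hn : 48 ≤ n) {s : ℝ} (hs : |s| = 1) :
    permAvg n (fun σ => Real.exp (s * permRise n σ)) ≤ Real.exp 47 := by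
  have hn0 : n ≠ 0 := by omega
  have hn1 : (1 : ℝ) ≤ n := by exact_mod_cast (by omega : 1 ≤ n)
  have hs2 : s ^ 2 = 1 := by rw [← sq_abs, hs, one_pow]
  have h : ∀ σ : Equiv.Perm (Fin n), Real.exp (s * permRise n σ) ≤ Real.exp 47 *
      ∏ j ∈ Finset.range n, (1 + ((j : ℝ) + 1 - rSeq n σ) * (√12 * s / (n * √n))) := fun σ => by
    obtain ⟨η, h1, h2⟩ := exists_prod_eq_exp_real (one_le_rSeq_real n σ) (rSeq_le_real hn0 σ)
      (s := s) (by rw [hs, mul_one]; exact sqrt_twelve_div_le hn)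
    have h3 := sq_normRise_le (one_le_rSeq_real n σ) (rSeq_le_real hn0 σ)
    have h4 : (1 + normRise n (rSeq n σ) ^ 2) / n ≤ 4 := by
      rw [div_le_iff₀ (by linarith)]; linarith
    have h5 : 42 / √(n : ℝ) ≤ 42 := div_le_self (by norm_num) (Real.one_le_sqrt.2 hn1)
    rw [hs] at h2
    simp only [one_pow, one_mul, mul_one] at h2
    rw [h1, ← Real.exp_add, Real.exp_le_exp, hs2, permRise]
    have := (abs_le.1 h2).1
    linarith
  refine (permAvg_mono h).trans ?_
  rw [permAvg_const_mul, permAvg_prod_real hn0, mul_one]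

lemma permAvg_sq_le {n : ℕ} (hn : 48 ≤ n) :
    permAvg n (fun σ => permRise n σ ^ 2) ≤ 4 * Real.exp 47 := by
  have h1 := permAvg_exp_le hn (s := 1) (by simp)
  have h2 := permAvg_exp_le hn (s := -1) (by simp)
  refine (permAvg_mono (G := fun σ => 2 * Real.exp (1 * permRise n σ) +
    2 * Real.exp (-1 * permRise n σ)) fun σ => ?_).trans ?_
  · set y := permRise n σ
    have e1 := Real.exp_pos (1 * y)
    have e2 := Real.exp_pos (-1 * y)
    rcases le_total 0 y with h | h
    · have := Real.quadratic_le_exp_of_nonneg (x := 1 * y) (by linarith)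
      nlinarith
    · have := Real.quadratic_le_exp_of_nonneg (x := -1 * y) (by linarith)
      nlinarith
  · rw [permAvg_add, permAvg_const_mul, permAvg_const_mul]; linarith

lemma permAvg_sq_normRise_err_le {n : ℕ} (hn : 48 ≤ n) {x y : ℝ} (hx : 0 ≤ x) :
    permAvg n (fun σ => x * (1 + permRise n σ ^ 2) / n + y) ≤
      x * (1 + 4 * Real.exp 47) / n + y := by
  have h : (fun σ : Equiv.Perm (Fin n) => x * (1 + permRise n σ ^ 2) / n + y) =
      fun σ => (x / n * permRise n σ ^ 2) + (x / n + y) := by ext σ; ring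
  rw [h, permAvg_add, permAvg_const_mul, permAvg_const]
  have := mul_le_mul_of_nonneg_left (permAvg_sq_le hn) (by positivity : 0 ≤ x / n)
  calc _ ≤ x / n * (4 * Real.exp 47) + (x / n + y) := by linarith
    _ = _ := by ring

lemma tendsto_sqrt_natCast_atTop : Tendsto (fun n : ℕ => √(n : ℝ)) atTop atTop :=
  Real.tendsto_sqrt_atTop.comp tendsto_natCast_atTop_atTop

lemma norm_permAvg_char_sub_le {n : ℕ} (hn : 48 ≤ n) {θ : ℝ} (hθ : √12 * |θ| / √n ≤ 1 / 2) :
    ‖permAvg n (fun σ => Complex.exp (θ * permRise n σ * Complex.I)) -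
      Complex.exp (-(θ ^ 2 / 2))‖ ≤ Real.exp (4 * |θ| ^ 2 + 42 * |θ| ^ 3) *
      (|θ| ^ 2 * (1 + 4 * Real.exp 47) / n + 42 * |θ| ^ 3 / √n) := by
  have hn0 : n ≠ 0 := by omega
  have hn1 : (1 : ℝ) ≤ n := by exact_mod_cast (by omega : 1 ≤ n)
  have hnorm : ‖(θ * Complex.I : ℂ)‖ = |θ| := by simp
  set M := 4 * |θ| ^ 2 + 42 * |θ| ^ 3 with hM
  set w : ℂ := (√12 : ℝ) * (θ * Complex.I) / ((n * √n : ℝ) : ℂ) with hw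
  have hpt : ∀ σ : Equiv.Perm (Fin n),
      ‖Complex.exp (θ * permRise n σ * Complex.I) - Complex.exp (-(θ ^ 2 / 2)) *
        ∏ j ∈ Finset.range n, (1 + (((j : ℝ) + 1 - rSeq n σ : ℝ) : ℂ) * w)‖ ≤
      Real.exp M * (|θ| ^ 2 * (1 + permRise n σ ^ 2) / n + 42 * |θ| ^ 3 / √n) := fun σ => by
    obtain ⟨η, h1, h2⟩ := exists_prod_eq_exp (one_le_rSeq_real n σ) (rSeq_le_real hn0 σ)
      (s := θ * Complex.I) (by rwa [hnorm])
    rw [hnorm] at h2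
    have h3 := sq_normRise_le (one_le_rSeq_real n σ) (rSeq_le_real hn0 σ)
    have h4 : ‖η‖ ≤ M := by
      refine h2.trans ?_
      have h4 : (1 + normRise n (rSeq n σ) ^ 2) / n ≤ 4 := by
        rw [div_le_iff₀ (by linarith)]; linarith
      have h5 : 42 * |θ| ^ 3 / √(n : ℝ) ≤ 42 * |θ| ^ 3 :=
        div_le_self (by positivity) (Real.one_le_sqrt.2 hn1)
      have h6 := mul_le_mul_of_nonneg_left h4 (by positivity : 0 ≤ |θ| ^ 2)
      rw [mul_div_assoc]
      linarith
    rw [h1, ← Complex.exp_add]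
    have e1 : (-(θ ^ 2 / 2) + (θ * Complex.I * (normRise n (rSeq n σ) : ℝ) -
        (θ * Complex.I) ^ 2 / 2 + η) : ℂ) =
        ((θ * permRise n σ : ℝ) : ℂ) * Complex.I + η := by
      rw [permRise, mul_pow, Complex.I_sq]; push_cast; ring
    have e2 : (θ * permRise n σ * Complex.I : ℂ) =
        ((θ * permRise n σ : ℝ) : ℂ) * Complex.I := by push_cast; ring
    rw [e1, e2, Complex.exp_add, ← mul_one_sub, norm_mul, Complex.norm_exp_ofReal_mul_I, one_mul,
      norm_sub_rev]
    have h7 := Complex.norm_exp_sub_sum_le_norm_mul_exp η 1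
    simp only [Finset.sum_range_one, pow_zero, Nat.factorial_zero, Nat.cast_one, div_one,
      pow_one] at h7
    calc ‖Complex.exp η - 1‖ ≤ ‖η‖ * Real.exp ‖η‖ := h7
      _ ≤ (|θ| ^ 2 * (1 + permRise n σ ^ 2) / n + 42 * |θ| ^ 3 / √n) * Real.exp M := by
        gcongr
        exact h2
      _ = _ := mul_comm _ _
  have h8 : permAvg n (fun σ => Complex.exp (θ * permRise n σ * Complex.I)) -
      Complex.exp (-(θ ^ 2 / 2)) = permAvg n (fun σ : Equiv.Perm (Fin n) =>
        Complex.exp (θ * permRise n σ * Complex.I) - Complex.exp (-(θ ^ 2 / 2)) *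
        ∏ j ∈ Finset.range n, (1 + (((j : ℝ) + 1 - rSeq n σ : ℝ) : ℂ) * w)) := by
    rw [permAvg_sub, permAvg_const_mul, permAvg_prod hn0, mul_one]
  rw [h8]
  refine (norm_permAvg_le _).trans ((permAvg_mono hpt).trans ?_)
  rw [permAvg_const_mul]
  gcongr
  exact permAvg_sq_normRise_err_le hn (by positivity)

lemma tendsto_permAvg_char (θ : ℝ) :
    Tendsto (fun n => permAvg n (fun σ => Complex.exp (θ * permRise n σ * Complex.I)))
      atTop (nhds (Complex.exp (-(θ ^ 2 / 2)))) := by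
  rw [tendsto_iff_norm_sub_tendsto_zero]
  have h1 : Tendsto (fun n : ℕ => √12 * |θ| / √(n : ℝ)) atTop (nhds 0) :=
    tendsto_sqrt_natCast_atTop.const_div_atTop _
  have h2 : Tendsto (fun n : ℕ => Real.exp (4 * |θ| ^ 2 + 42 * |θ| ^ 3) *
      (|θ| ^ 2 * (1 + 4 * Real.exp 47) / n + 42 * |θ| ^ 3 / √(n : ℝ))) atTop (nhds 0) := by
    have := ((tendsto_natCast_atTop_atTop (R := ℝ)).const_div_atTop
      (|θ| ^ 2 * (1 + 4 * Real.exp 47))).add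
      (tendsto_sqrt_natCast_atTop.const_div_atTop (42 * |θ| ^ 3))
    simpa only [add_zero, mul_zero] using
      this.const_mul (Real.exp (4 * |θ| ^ 2 + 42 * |θ| ^ 3))
  refine squeeze_zero' (Eventually.of_forall fun n => norm_nonneg _) ?_ h2
  filter_upwards [eventually_ge_atTop 48, h1.eventually (ge_mem_nhds (by norm_num : (0 : ℝ) < 1 / 2))]
    with n hn hθ
  exact norm_permAvg_char_sub_le hn hθ

/-- The law of the normalized number of rising sequences of a uniform permutation. -/
def riseLaw (n : ℕ) : Measure ℝ :=
  ∑ σ : Equiv.Perm (Fin n), ENNReal.ofReal (n.factorial : ℝ)⁻¹ • Measure.dirac (permRise n σ)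

instance (n : ℕ) : IsProbabilityMeasure (riseLaw n) := by
  constructor
  simp only [riseLaw, Measure.coe_finsetSum, Finset.sum_apply, Measure.smul_apply,
    measure_univ, smul_eq_mul, mul_one, Finset.sum_const, Finset.card_univ, Fintype.card_perm,
    Fintype.card_fin, nsmul_eq_mul]
  rw [ENNReal.ofReal_inv_of_pos (by positivity), ENNReal.ofReal_natCast,
    ENNReal.mul_inv_cancel (by exact_mod_cast Nat.factorial_ne_zero n) (by simp)]

lemma integral_riseLaw {E : Type*} [NormedAddCommGroup E] [NormedSpace ℝ E] [CompleteSpace E]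
    (n : ℕ) (g : ℝ → E) :
    ∫ x, g x ∂(riseLaw n) = (n.factorial : ℝ)⁻¹ • ∑ σ, g (permRise n σ) := by
  unfold riseLaw
  rw [integral_finsetSum_measure fun σ _ =>
    (integrable_dirac enorm_lt_top).smul_measure ENNReal.ofReal_ne_top, Finset.smul_sum]
  refine Finset.sum_congr rfl fun σ _ => ?_
  rw [integral_smul_measure, integral_dirac, ENNReal.toReal_ofReal (by positivity)]

/-- The central limit theorem for the number of rising sequences. -/
lemma tendsto_permAvg_gaussian (g : BoundedContinuousFunction ℝ ℝ) :
    Tendsto (fun n => permAvg n (fun σ => g (permRise n σ))) atTop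
      (nhds (∫ x, g x ∂(ProbabilityTheory.gaussianReal 0 1))) := by
  let μ : ℕ → ProbabilityMeasure ℝ := fun n => ⟨riseLaw n, inferInstance⟩
  let μ₀ : ProbabilityMeasure ℝ := ⟨ProbabilityTheory.gaussianReal 0 1, inferInstance⟩
  have h : Tendsto μ atTop (nhds μ₀) := by
    rw [ProbabilityMeasure.tendsto_iff_tendsto_charFun]
    intro θ
    convert tendsto_permAvg_char θ using 1
    · ext n
      rw [charFun_apply_real]
      change ∫ x, _ ∂(riseLaw n) = _
      rw [integral_riseLaw, permAvg, Complex.real_smul]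
      push_cast
      rfl
    · congr 1
      change charFun (ProbabilityTheory.gaussianReal 0 1) θ = _
      rw [ProbabilityTheory.charFun_gaussianReal]
      congr 1
      simp
  rw [ProbabilityMeasure.tendsto_iff_forall_integral_tendsto] at h
  refine (h g).congr fun n => ?_
  change ∫ x, g x ∂(riseLaw n) = _
  rw [integral_riseLaw]
  rfl

lemma integral_gaussian_posPart {s : ℝ} (hs : 0 ≤ s) :
    ∫ x, max 0 (1 - Real.exp (s * x - s ^ 2 / 2)) ∂(ProbabilityTheory.gaussianReal 0 1) =
      Psi (√12 * s) := by
  set φ : ℝ → ℝ := fun x => Real.exp (-x ^ 2 / 2) with hφ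
  have hφint : Integrable φ := by
    have := integrable_exp_neg_mul_sq (b := 1 / 2) (by norm_num)
    refine this.congr (Eventually.of_forall fun x => ?_)
    simp only [hφ]; congr 1; ring
  have hφint' : Integrable fun x => φ (x - s) := hφint.comp_sub_right s
  have h1 : ∀ x, ProbabilityTheory.gaussianPDFReal 0 1 x • max 0 (1 - Real.exp (s * x - s ^ 2 / 2))
      = (√(2 * Real.pi))⁻¹ * (Set.Iic (s / 2)).indicator (fun x => φ x - φ (x - s)) x := by
    intro x
    have e1 : ProbabilityTheory.gaussianPDFReal 0 1 x = (√(2 * Real.pi))⁻¹ * φ x := by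
      simp [ProbabilityTheory.gaussianPDFReal, hφ]
    have e2 : φ (x - s) = φ x * Real.exp (s * x - s ^ 2 / 2) := by
      simp only [hφ]; rw [← Real.exp_add]; congr 1; ring
    have e3 : 0 < φ x := Real.exp_pos _
    rw [e1, smul_eq_mul, mul_assoc]
    congr 1
    by_cases hx : x ≤ s / 2
    · rw [Set.indicator_of_mem (Set.mem_Iic.2 hx), e2, max_eq_right]
      · ring
      · rw [sub_nonneg, Real.exp_le_one_iff]; nlinarith
    · rw [Set.indicator_of_notMem (by simpa using hx), max_eq_left, mul_zero]
      rw [sub_nonpos, Real.one_le_exp_iff]; push Not at hx; nlinarith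
  rw [ProbabilityTheory.integral_gaussianReal_eq_integral_smul one_ne_zero]
  simp_rw [h1]
  rw [integral_const_mul, integral_indicator measurableSet_Iic,
    integral_sub hφint.integrableOn hφint'.integrableOn]
  have h2 : ∫ x in Set.Iic (s / 2), φ (x - s) = ∫ x in Set.Iic (-(s / 2)), φ x := by
    rw [← integral_indicator measurableSet_Iic, ← integral_indicator measurableSet_Iic,
      ← integral_sub_right_eq_self ((Set.Iic (-(s / 2))).indicator φ) s]
    congr 1
    ext x
    by_cases hx : x ≤ s / 2
    · rw [Set.indicator_of_mem (Set.mem_Iic.2 hx),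
        Set.indicator_of_mem (Set.mem_Iic.2 (by linarith))]
    · rw [Set.indicator_of_notMem (by simpa using hx),
        Set.indicator_of_notMem (by rw [Set.mem_Iic]; intro h; exact hx (by linarith))]
  have h3 : √12 * s / (4 * √3) = s / 2 := by
    have : √12 = 2 * √3 := by
      rw [show (12 : ℝ) = 2 ^ 2 * 3 by norm_num, Real.sqrt_mul (by norm_num),
        Real.sqrt_sq (by norm_num)]
    have h4 : √3 ≠ 0 := by positivity
    rw [this]; field_simp; ring
  rw [h2, intervalIntegral.integral_Iic_sub_Iic hφint.integrableOn hφint.integrableOn, Psi, h3]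

/-- The density of the `a`-shuffle with respect to the uniform distribution. -/
def shuffleDensity (n a : ℕ) (σ : Equiv.Perm (Fin n)) : ℝ :=
  ∏ j ∈ Finset.range n, (1 + ((j : ℝ) + 1 - rSeq n σ) * (a : ℝ)⁻¹)

lemma Qs_eq_shuffleDensity {n a : ℕ} (hn : n ≠ 0) (ha : a ≠ 0) (σ : Equiv.Perm (Fin n)) :
    Qs n a σ = (n.factorial : ℝ)⁻¹ * shuffleDensity n a σ := by
  have ha' : (a : ℝ) ≠ 0 := by exact_mod_cast ha
  have hf : ((n.factorial : ℕ) : ℝ) ≠ 0 := by exact_mod_cast Nat.factorial_ne_zero _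
  have h : (n.factorial : ℝ) * ((n + a - rSeq n σ).choose n : ℝ) =
      ∏ j ∈ Finset.range n, ((a : ℝ) + ((j : ℝ) + 1 - rSeq n σ)) := by
    rw [← Complex.ofReal_inj]
    push_cast
    rw [factorial_mul_choose a (by exact_mod_cast rSeq_le_real hn σ)]
    push_cast
    rfl
  have h2 : shuffleDensity n a σ * (a : ℝ) ^ n =
      ∏ j ∈ Finset.range n, ((a : ℝ) + ((j : ℝ) + 1 - rSeq n σ)) := by
    unfold shuffleDensity
    rw [Finset.pow_eq_prod_const, ← Finset.prod_mul_distrib]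
    refine Finset.prod_congr rfl fun j _ => ?_
    field_simp
  rw [Qs]
  field_simp
  linarith

lemma shuffleDensity_nonneg {n a : ℕ} (hn : n ≠ 0) (ha : a ≠ 0) (σ : Equiv.Perm (Fin n)) :
    0 ≤ shuffleDensity n a σ := by
  have h1 := Qs_eq_shuffleDensity hn ha σ
  have h2 : 0 ≤ Qs n a σ := by unfold Qs; positivity
  have hf : (0 : ℝ) < (n.factorial : ℝ)⁻¹ := by positivity
  rw [h1] at h2
  exact nonneg_of_mul_nonneg_right h2 hf

lemma tv_Qs_Us {n a : ℕ} (hn : n ≠ 0) (ha : a ≠ 0) :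
    tv n (Qs n a) (Us n) = permAvg n (fun σ => max 0 (1 - shuffleDensity n a σ)) := by
  have h1 : permAvg n (shuffleDensity n a) = 1 := permAvg_prod_real hn _
  have h2 : tv n (Qs n a) (Us n) = permAvg n (fun σ => max 0 (1 - shuffleDensity n a σ) +
      (1 / 2) * (shuffleDensity n a σ - 1)) := by
    unfold tv permAvg
    rw [Finset.mul_sum, Finset.mul_sum]
    refine Finset.sum_congr rfl fun σ _ => ?_
    have h3 : (0 : ℝ) ≤ (n.factorial : ℝ)⁻¹ := by positivity
    rw [Qs_eq_shuffleDensity hn ha, Us, ← mul_sub_one, abs_mul, abs_of_nonneg h3]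
    rcases le_total (shuffleDensity n a σ) 1 with h | h
    · rw [abs_of_nonpos (by linarith), max_eq_right (by linarith)]; ring
    · rw [abs_of_nonneg (by linarith), max_eq_left (by linarith)]; ring
  rw [h2, permAvg_add, permAvg_const_mul, permAvg_sub, h1, permAvg_const]
  ring

lemma abs_posPart_one_sub_exp_sub_le (u v : ℝ) :
    |max 0 (1 - Real.exp u) - max 0 (1 - Real.exp v)| ≤ |u - v| := by
  wlog h : u ≤ v generalizing u v
  · rw [abs_sub_comm, abs_sub_comm u]
    exact this v u (by linarith)
  have h1 : max 0 (1 - Real.exp v) ≤ max 0 (1 - Real.exp u) := by gcongr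
  rw [abs_of_nonneg (by linarith), abs_of_nonpos (by linarith)]
  rcases le_total 0 u with hu | hu
  · have e1 : 1 ≤ Real.exp u := Real.one_le_exp hu
    rw [max_eq_left (by linarith : 1 - Real.exp u ≤ 0)]
    have := le_max_left 0 (1 - Real.exp v)
    linarith
  · have e1 : Real.exp u ≤ 1 := Real.exp_le_one_iff.2 hu
    have e2 : Real.exp v = Real.exp u * Real.exp (v - u) := by rw [← Real.exp_add]; congr 1; ring
    rw [max_eq_right (by linarith : 0 ≤ 1 - Real.exp u)]
    rcases le_total 0 v with hv | hv
    · have e3 := Real.add_one_le_exp u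
      have := le_max_left 0 (1 - Real.exp v)
      linarith
    · have e3 := Real.add_one_le_exp (u - v)
      have e4 : Real.exp u = Real.exp v * Real.exp (u - v) := by
        rw [← Real.exp_add]; congr 1; ring
      have e5 : Real.exp v ≤ 1 := Real.exp_le_one_iff.2 hv
      have := le_max_right 0 (1 - Real.exp v)
      have e6 : Real.exp v * (u - v + 1) ≤ Real.exp u := by
        rw [e4]; exact mul_le_mul_of_nonneg_left e3 (Real.exp_pos _).le
      nlinarith [Real.exp_pos v]

/-- The scale `n^{3/2} / (√12 a)` governing the distance of the `a`-shuffle to uniformity. -/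
def shuffleScale (n a : ℕ) : ℝ := n * √n / (√12 * a)

lemma shuffleScale_nonneg (n a : ℕ) : 0 ≤ shuffleScale n a := by
  unfold shuffleScale; positivity

lemma inv_eq_shuffleScale {n a : ℕ} (hn : n ≠ 0) (ha : a ≠ 0) :
    (a : ℝ)⁻¹ = √12 * shuffleScale n a / (n * √n) := by
  have hn' : (0 : ℝ) < n := by positivity
  have ha' : (0 : ℝ) < a := by positivity
  have := Real.sqrt_pos.2 hn'
  have : (0 : ℝ) < √12 := by positivity
  unfold shuffleScale
  field_simp

lemma abs_tv_sub_le {n a : ℕ} (hn : 48 ≤ n) (ha : a ≠ 0) {s : ℝ}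
    (hs : √12 * shuffleScale n a / √n ≤ 1 / 2) :
    |tv n (Qs n a) (Us n) -
      permAvg n (fun σ => max 0 (1 - Real.exp (s * permRise n σ - s ^ 2 / 2)))| ≤
    |shuffleScale n a - s| * (1 + 4 * Real.exp 47) +
      |shuffleScale n a ^ 2 - s ^ 2| / 2 +
      (shuffleScale n a ^ 2 * (1 + 4 * Real.exp 47) / n + 42 * shuffleScale n a ^ 3 / √n) := by
  have hn0 : n ≠ 0 := by omega
  set t := shuffleScale n a with ht
  have ht0 : 0 ≤ t := shuffleScale_nonneg n a
  rw [tv_Qs_Us hn0 ha, ← permAvg_sub]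
  refine (abs_permAvg_le _).trans ?_
  have hpt : ∀ σ : Equiv.Perm (Fin n), |max 0 (1 - shuffleDensity n a σ) -
      max 0 (1 - Real.exp (s * permRise n σ - s ^ 2 / 2))| ≤
      |t - s| * permRise n σ ^ 2 + ((|t - s| + |t ^ 2 - s ^ 2| / 2) +
        (t ^ 2 * (1 + permRise n σ ^ 2) / n + 42 * t ^ 3 / √n)) := fun σ => by
    obtain ⟨η, h1, h2⟩ := exists_prod_eq_exp_real (one_le_rSeq_real n σ) (rSeq_le_real hn0 σ)
      (s := t) (by rwa [abs_of_nonneg ht0])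
    rw [shuffleDensity, inv_eq_shuffleScale hn0 ha, h1]
    refine (abs_posPart_one_sub_exp_sub_le _ _).trans ?_
    rw [abs_of_nonneg ht0] at h2
    change |η| ≤ t ^ 2 * (1 + permRise n σ ^ 2) / n + 42 * t ^ 3 / √n at h2
    change |t * permRise n σ - t ^ 2 / 2 + η - _| ≤ _
    have e : t * permRise n σ - t ^ 2 / 2 + η - (s * permRise n σ - s ^ 2 / 2) =
        (t - s) * permRise n σ + (-((t ^ 2 - s ^ 2) / 2) + η) := by ring
    have h3 : |(t - s) * permRise n σ| ≤ |t - s| * (permRise n σ ^ 2 + 1) := by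
      rw [abs_mul]
      gcongr
      nlinarith [sq_nonneg (|permRise n σ| - 1), sq_abs (permRise n σ), abs_nonneg (permRise n σ)]
    have h4 : |-((t ^ 2 - s ^ 2) / 2)| = |t ^ 2 - s ^ 2| / 2 := by
      rw [abs_neg, abs_div, abs_of_pos (by norm_num : (0 : ℝ) < 2)]
    rw [e]
    have h5 := abs_add_le ((t - s) * permRise n σ) (-((t ^ 2 - s ^ 2) / 2) + η)
    have h6 := abs_add_le (-((t ^ 2 - s ^ 2) / 2)) η
    linarith
  refine (permAvg_mono hpt).trans ?_
  rw [permAvg_add, permAvg_add, permAvg_const_mul, permAvg_const]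
  have h7 := permAvg_sq_normRise_err_le hn (y := 42 * t ^ 3 / √n) (sq_nonneg t)
  have h8 := mul_le_mul_of_nonneg_left (permAvg_sq_le hn) (abs_nonneg (t - s))
  linarith

/-- The bounded continuous function whose Gaussian mean is the limiting distance. -/
def posPartOneSubExp (s : ℝ) : BoundedContinuousFunction ℝ ℝ :=
  BoundedContinuousFunction.ofNormedAddCommGroup
    (fun x => max 0 (1 - Real.exp (s * x - s ^ 2 / 2))) (by fun_prop) 1 (fun x => by
      rw [Real.norm_of_nonneg (le_max_left _ _)]
      exact max_le zero_le_one (by linarith [Real.exp_pos (s * x - s ^ 2 / 2)]))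

lemma tendsto_tv_of_tendsto_shuffleScale {a : ℕ → ℕ} (ha : ∀ n, a n ≠ 0) {s : ℝ}
    (h : Tendsto (fun n => shuffleScale n (a n)) atTop (nhds s)) :
    Tendsto (fun n => tv n (Qs n (a n)) (Us n)) atTop (nhds (Psi (√12 * s))) := by
  have hs : 0 ≤ s := ge_of_tendsto' h fun n => shuffleScale_nonneg _ _
  have h1 := tendsto_permAvg_gaussian (posPartOneSubExp s)
  have h2 : ∫ x, posPartOneSubExp s x ∂(ProbabilityTheory.gaussianReal 0 1) = Psi (√12 * s) :=
    integral_gaussian_posPart hs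
  rw [h2] at h1
  refine h1.congr_dist ?_
  have hsqrt : Tendsto (fun n : ℕ => (√(n : ℝ))⁻¹) atTop (nhds 0) :=
    tendsto_sqrt_natCast_atTop.inv_tendsto_atTop
  have hinv : Tendsto (fun n : ℕ => (n : ℝ)⁻¹) atTop (nhds 0) :=
    (tendsto_natCast_atTop_atTop (R := ℝ)).inv_tendsto_atTop
  have e1 : Tendsto (fun n => |shuffleScale n (a n) - s|) atTop (nhds 0) := by
    simpa using (h.sub_const s).abs
  have e2 : Tendsto (fun n => |shuffleScale n (a n) ^ 2 - s ^ 2|) atTop (nhds 0) := by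
    have := ((h.pow 2).sub_const (s ^ 2)).abs
    rwa [show |s ^ 2 - s ^ 2| = 0 by rw [sub_self, abs_zero]] at this
  have e3 : Tendsto (fun n => shuffleScale n (a n) ^ 2 * (1 + 4 * Real.exp 47) / n)
      atTop (nhds 0) := by
    simpa only [mul_zero, div_eq_mul_inv] using ((h.pow 2).mul_const (1 + 4 * Real.exp 47)).mul hinv
  have e4 : Tendsto (fun n => 42 * shuffleScale n (a n) ^ 3 / √(n : ℝ)) atTop (nhds 0) := by
    simpa only [mul_zero, div_eq_mul_inv] using ((h.pow 3).const_mul 42).mul hsqrt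
  have e5 : Tendsto (fun n => √12 * shuffleScale n (a n) / √(n : ℝ)) atTop (nhds 0) := by
    simpa only [mul_zero, div_eq_mul_inv] using (h.const_mul √12).mul hsqrt
  have e6 := ((e1.mul_const (1 + 4 * Real.exp 47)).add (e2.div_const 2)).add (e3.add e4)
  simp only [zero_mul, zero_div, add_zero] at e6
  refine squeeze_zero' (Eventually.of_forall fun n => dist_nonneg) ?_ e6
  filter_upwards [eventually_ge_atTop 48, e5.eventually (ge_mem_nhds (by norm_num : (0 : ℝ) < 1 / 2))]
    with n hn hs'
  rw [dist_comm, Real.dist_eq]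
  exact abs_tv_sub_le hn (ha n) hs'

lemma one_add_le_exp_sub_sq {x : ℝ} (hx : 0 ≤ 1 + x) (hx' : x ≤ 4) :
    1 + x ≤ Real.exp (x - x ^ 2 / 16) := by
  set v := √(1 + x) with hv
  have hv0 : 0 ≤ v := Real.sqrt_nonneg _
  have hv2 : v ^ 2 = 1 + x := Real.sq_sqrt hx
  have hv3 : v ≤ 3 := by nlinarith
  have h1 : v ≤ Real.exp (v - 1) := by simpa using Real.add_one_le_exp (v - 1)
  calc 1 + x = v ^ 2 := hv2.symm
    _ ≤ Real.exp (v - 1) ^ 2 := by gcongr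
    _ = Real.exp (2 * (v - 1)) := by rw [← Real.exp_nat_mul]; norm_num
    _ ≤ Real.exp (x - x ^ 2 / 16) := by
      rw [Real.exp_le_exp]
      have hxv : x = v ^ 2 - 1 := by linarith
      clear_value v
      subst hxv
      have : (v - 1) ^ 2 * (16 - (v + 1) ^ 2) ≥ 0 :=
        mul_nonneg (sq_nonneg _) (by nlinarith)
      nlinarith

lemma shuffleDensity_le {n a : ℕ} (hn : 2 ≤ n) (ha : a ≠ 0) {K : ℝ}
    (hK : K * √n ≤ √12 * ((n + 1) / 4)) {σ : Equiv.Perm (Fin n)} (hσ : permRise n σ ≤ K) :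
    shuffleDensity n a σ ≤ Real.exp (shuffleScale n a * K - shuffleScale n a ^ 2 / 32) := by
  have hn0 : n ≠ 0 := by omega
  have hn2 : (2 : ℝ) ≤ n := by exact_mod_cast hn
  have ha0 : (0 : ℝ) < a := by positivity
  have hsn : 0 < √(n : ℝ) := Real.sqrt_pos.2 (by linarith)
  have hsq : √(n : ℝ) ^ 2 = n := Real.sq_sqrt (by linarith)
  have h12 : √(12 : ℝ) ^ 2 = 12 := Real.sq_sqrt (by norm_num)
  have h12' : (0 : ℝ) < √12 := by positivity
  set r := rSeq n σ with hr
  have hr1 : (1 : ℝ) ≤ r := one_le_rSeq_real n σ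
  have hrn : (r : ℝ) ≤ n := rSeq_le_real hn0 σ
  have hr4 : ((n : ℝ) + 1) / 4 ≤ r := by
    have h1 : √12 * ((n + 1) / 2 - r) ≤ K * √n := by
      have := hσ
      rwa [permRise, normRise, div_le_iff₀ hsn] at this
    have := le_of_mul_le_mul_left (h1.trans hK) h12'
    linarith
  rcases lt_or_ge a r with har | har
  · have : shuffleDensity n a σ = 0 := by
      have hrn' : r ≤ n := by exact_mod_cast hrn
      refine Finset.prod_eq_zero (i := r - a - 1) (Finset.mem_range.2 (by omega)) ?_
      have : ((r - a - 1 : ℕ) : ℝ) = r - a - 1 := by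
        rw [Nat.cast_sub (by omega), Nat.cast_sub (by omega), Nat.cast_one]
      rw [← hr, this]
      field_simp
      ring
    rw [this]
    positivity
  · have har' : (r : ℝ) ≤ a := by exact_mod_cast har
    have hinv := inv_eq_shuffleScale hn0 ha
    set t := shuffleScale n a with ht
    have hj : ∀ j ∈ Finset.range n, 0 ≤ 1 + ((j : ℝ) + 1 - r) * (a : ℝ)⁻¹ ∧
        ((j : ℝ) + 1 - r) * (a : ℝ)⁻¹ ≤ 4 := fun j hj => by
      have hj' : (j : ℝ) + 1 ≤ n := by exact_mod_cast Finset.mem_range.1 hj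
      have hj0 : (0 : ℝ) ≤ j := Nat.cast_nonneg j
      constructor
      · have : 1 + ((j : ℝ) + 1 - r) * (a : ℝ)⁻¹ = (a - r + (j + 1)) / a := by field_simp; ring
        rw [this]
        exact div_nonneg (by linarith) ha0.le
      · rw [← div_eq_mul_inv, div_le_iff₀ ha0]
        linarith
    calc shuffleDensity n a σ
        ≤ ∏ j ∈ Finset.range n, Real.exp (((j : ℝ) + 1 - r) * (a : ℝ)⁻¹ -
            (((j : ℝ) + 1 - r) * (a : ℝ)⁻¹) ^ 2 / 16) :=
          Finset.prod_le_prod (fun j h => (hj j h).1)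
            fun j h => one_add_le_exp_sub_sq (hj j h).1 (hj j h).2
      _ = Real.exp (n * ((n + 1) / 2 - r) * (a : ℝ)⁻¹ -
            n * ((n ^ 2 - 1) / 12 + ((n + 1) / 2 - r) ^ 2) * ((a : ℝ)⁻¹) ^ 2 / 16) := by
          rw [← Real.exp_sum, Finset.sum_sub_distrib, ← Finset.sum_mul, ← Finset.sum_div]
          simp_rw [mul_pow]
          rw [← Finset.sum_mul, sum_shift, sum_shift_sq]
      _ ≤ _ := by
          rw [Real.exp_le_exp]
          have e1 : n * ((n + 1) / 2 - r) * (a : ℝ)⁻¹ = t * permRise n σ := by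
            rw [hinv, permRise, normRise, ← hr]; field_simp
          have e2 : n * (((n : ℝ) ^ 2 - 1) / 12) * ((a : ℝ)⁻¹) ^ 2 =
              t ^ 2 * (1 - 1 / (n : ℝ) ^ 2) := by
            rw [hinv, div_pow, mul_pow, mul_pow, h12, hsq]; field_simp
          have e3 : 1 / (n : ℝ) ^ 2 ≤ 1 / 2 := by
            apply one_div_le_one_div_of_le <;> nlinarith
          have e4 : t ^ 2 * (1 / 2) ≤ t ^ 2 * (1 - 1 / (n : ℝ) ^ 2) := by gcongr; linarith
          have e5 : 0 ≤ n * ((n + 1) / 2 - (r : ℝ)) ^ 2 * ((a : ℝ)⁻¹) ^ 2 := by positivity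
          have e6 : t * permRise n σ ≤ t * K :=
            mul_le_mul_of_nonneg_left hσ (shuffleScale_nonneg n a)
          have e7 : n * (((n : ℝ) ^ 2 - 1) / 12 + ((n + 1) / 2 - r) ^ 2) * ((a : ℝ)⁻¹) ^ 2 =
              n * (((n : ℝ) ^ 2 - 1) / 12) * ((a : ℝ)⁻¹) ^ 2 +
              n * ((n + 1) / 2 - (r : ℝ)) ^ 2 * ((a : ℝ)⁻¹) ^ 2 := by ring
          rw [e1, e7, e2]
          linarith

lemma tv_le_one {n a : ℕ} (hn : n ≠ 0) (ha : a ≠ 0) : tv n (Qs n a) (Us n) ≤ 1 := by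
  rw [tv_Qs_Us hn ha]
  refine (permAvg_mono (G := fun _ => 1) fun σ => ?_).trans (permAvg_const n 1).le
  exact max_le zero_le_one (by linarith [shuffleDensity_nonneg hn ha σ])

lemma le_tv {n a : ℕ} (hn : 48 ≤ n) (ha : a ≠ 0) {K : ℝ}
    (hK : K * √n ≤ √12 * ((n + 1) / 4)) :
    1 - Real.exp (shuffleScale n a * K - shuffleScale n a ^ 2 / 32) - Real.exp (47 - K) ≤
      tv n (Qs n a) (Us n) := by
  have hn0 : n ≠ 0 := by omega
  set δ := Real.exp (shuffleScale n a * K - shuffleScale n a ^ 2 / 32) with hδ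
  have hδ0 : 0 < δ := Real.exp_pos _
  have h1 : permAvg n (fun σ => (1 - δ) - Real.exp (-K) * Real.exp (1 * permRise n σ)) ≤
      tv n (Qs n a) (Us n) := by
    rw [tv_Qs_Us hn0 ha]
    refine permAvg_mono fun σ => ?_
    rw [← Real.exp_add]
    rcases le_total (permRise n σ) K with h | h
    · have h2 := shuffleDensity_le (by omega) ha hK h
      have h3 := Real.exp_pos (-K + 1 * permRise n σ)
      exact le_max_of_le_right (by linarith)
    · have h3 : 1 ≤ Real.exp (-K + 1 * permRise n σ) := Real.one_le_exp (by linarith)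
      exact le_max_of_le_left (by linarith)
  rw [permAvg_sub, permAvg_const, permAvg_const_mul] at h1
  have h2 := mul_le_mul_of_nonneg_left (permAvg_exp_le hn (s := 1) (by simp))
    (Real.exp_pos (-K)).le
  rw [← Real.exp_add, show -K + 47 = 47 - K by ring] at h2
  linarith

lemma tendsto_tv_of_shuffleScale_atTop {a : ℕ → ℕ} (ha : ∀ n, a n ≠ 0)
    (h : Tendsto (fun n => shuffleScale n (a n)) atTop atTop) :
    Tendsto (fun n => tv n (Qs n (a n)) (Us n)) atTop (nhds 1) := by
  rw [tendsto_order]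
  refine ⟨fun b hb => ?_, fun b hb => ?_⟩
  · obtain ⟨K, hK⟩ : ∃ K : ℝ, Real.exp (47 - K) < (1 - b) / 2 := by
      have : Tendsto (fun K : ℝ => Real.exp (47 - K)) atTop (nhds 0) :=
        Real.tendsto_exp_atBot.comp (tendsto_atBot_add_const_left _ 47 tendsto_neg_atTop_atBot)
      exact (this.eventually (gt_mem_nhds (by linarith : 0 < (1 - b) / 2))).exists
    have h1 : Tendsto (fun t : ℝ => Real.exp (t * K - t ^ 2 / 32)) atTop (nhds 0) := by
      refine Real.tendsto_exp_atBot.comp ?_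
      have : Tendsto (fun t : ℝ => t * (t / 32 - K)) atTop atTop :=
        tendsto_id.atTop_mul_atTop₀
          (tendsto_atTop_add_const_right _ _ (tendsto_id.atTop_div_const (by norm_num)))
      refine (tendsto_neg_atTop_atBot.comp this).congr fun t => ?_
      simp only [Function.comp]
      ring
    filter_upwards [eventually_ge_atTop 48,
      (h1.comp h).eventually (gt_mem_nhds (by linarith : 0 < (1 - b) / 2)),
      tendsto_sqrt_natCast_atTop.eventually_ge_atTop (4 * K)] with n hn h2 h3
    have hK' : K * √n ≤ √12 * ((n + 1) / 4) := by
      have h4 : √(n : ℝ) ^ 2 = n := Real.sq_sqrt (Nat.cast_nonneg n)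
      have h5 : (1 : ℝ) ≤ √12 := Real.one_le_sqrt.2 (by norm_num)
      have h6 : (0 : ℝ) ≤ n := Nat.cast_nonneg n
      have h7 : K * √n ≤ n / 4 := by nlinarith [Real.sqrt_nonneg (n : ℝ)]
      nlinarith
    have := le_tv hn (ha n) hK'
    simp only [Function.comp] at h2
    linarith
  · filter_upwards [eventually_ge_atTop 1] with n hn
    exact (tv_le_one (by omega) (ha n)).trans_lt hb

lemma shuffleScale_eq_exp {n a : ℕ} (hn : n ≠ 0) (ha : a ≠ 0) :
    shuffleScale n a = (√12)⁻¹ * Real.exp (3 / 2 * Real.log n - Real.log a) := by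
  have hn' : (0 : ℝ) < n := by positivity
  have ha' : (0 : ℝ) < a := by positivity
  have h : 3 / 2 * Real.log n = Real.log n + Real.log √n := by
    rw [Real.log_sqrt hn'.le]; ring
  rw [h, Real.exp_sub, Real.exp_add, Real.exp_log hn', Real.exp_log ha',
    Real.exp_log (Real.sqrt_pos.2 hn'), shuffleScale]
  field_simp

lemma Psi_zero : Psi 0 = 0 := by simp [Psi]

/-- The limit profile of the `a`-shuffle in terms of `log (n^{3/2} / a)`. -/
lemma tendsto_tv_Qs {a : ℕ → ℕ} (ha : ∀ n, a n ≠ 0) {L : EReal}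
    (hL : Tendsto (fun n : ℕ => ((3 / 2 * Real.log n - Real.log (a n) : ℝ) : EReal))
      atTop (nhds L)) :
    Tendsto (fun n => tv n (Qs n (a n)) (Us n)) atTop (nhds (PsiExp L)) := by
  have hev : (fun n : ℕ => (√12)⁻¹ * Real.exp (3 / 2 * Real.log n - Real.log (a n))) =ᶠ[atTop]
      fun n => shuffleScale n (a n) := by
    filter_upwards [eventually_ne_atTop 0] with n hn
    exact (shuffleScale_eq_exp hn (ha n)).symm
  have h12 : (0 : ℝ) < √12 := by positivity
  induction L with
  | bot =>
    have h1 := Real.tendsto_exp_atBot.comp (EReal.tendsto_coe_nhds_bot_iff.1 hL)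
    have h2 := tendsto_tv_of_tendsto_shuffleScale ha ((h1.const_mul (√12)⁻¹).congr' hev)
    simpa [PsiExp, Psi_zero] using h2
  | coe x =>
    have h1 := (Real.continuous_exp.tendsto x).comp (EReal.tendsto_coe.1 hL)
    have h2 := tendsto_tv_of_tendsto_shuffleScale ha ((h1.const_mul (√12)⁻¹).congr' hev)
    rw [mul_inv_cancel_left₀ h12.ne'] at h2
    simpa [PsiExp] using h2
  | top =>
    have h1 := Real.tendsto_exp_atTop.comp (EReal.tendsto_coe_nhds_top_iff.1 hL)
    have h2 := tendsto_tv_of_shuffleScale_atTop ha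
      ((h1.const_mul_atTop (inv_pos.2 h12)).congr' hev)
    simpa [PsiExp] using h2

lemma floor_curly (t : ℝ) : ⌊curly t⌋₊ = if t < 1 / 2 then 0 else (round t).toNat := by
  unfold curly
  split_ifs with h
  · norm_num
  · rw [← Int.floor_toNat, Int.floor_intCast]

/-- If `m_n → ∞` and `d(t_n)·μ_n → L ∈ [-∞, ∞]`, then the total variation distance after
`⌊{t_n}⌋` shuffles converges to `Ψ(e^L)`. -/
theorem m_shuffle_limit_profile (m : ℕ → ℕ) (hm : ∀ n, 2 ≤ m n)
    (hm' : Filter.Tendsto m Filter.atTop Filter.atTop) (L : EReal)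
    (hL : Filter.Tendsto
      (fun n : ℕ => ((dOf (3 * Real.log n / (2 * Real.log (m n))) * Real.log (m n) : ℝ) : EReal))
      Filter.atTop (nhds L)) :
    Filter.Tendsto (fun n : ℕ =>
      tv n (iterConv n (Qs n (m n)) ⌊curly (3 * Real.log n / (2 * Real.log (m n)))⌋₊) (Us n))
      Filter.atTop (nhds (PsiExp L)) := by
  set a : ℕ → ℕ := fun n => m n ^ ⌊curly (3 * Real.log n / (2 * Real.log (m n)))⌋₊ with ha
  have ha0 : ∀ n, a n ≠ 0 := fun n => pow_ne_zero _ (by have := hm n; omega)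
  have hlogm : ∀ n, 0 < Real.log (m n) := fun n =>
    Real.log_pos (by exact_mod_cast (by have := hm n; omega : 1 < m n))
  have hlarge : ∀ n : ℕ, 1 / 2 ≤ 3 * Real.log n / (2 * Real.log (m n)) →
      dOf (3 * Real.log n / (2 * Real.log (m n))) * Real.log (m n) =
        3 / 2 * Real.log n - Real.log (a n) := fun n h => by
    have hr : 0 ≤ round (3 * Real.log n / (2 * Real.log (m n))) := by
      rw [round_eq, Int.floor_nonneg]; linarith
    have hc : (((round (3 * Real.log n / (2 * Real.log (m n)))).toNat : ℕ) : ℝ) =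
        (round (3 * Real.log n / (2 * Real.log (m n))) : ℝ) := by
      exact_mod_cast Int.toNat_of_nonneg hr
    rw [ha]
    simp only
    rw [floor_curly, dOf, if_neg (not_lt.2 h), if_neg (not_lt.2 h), Nat.cast_pow, Real.log_pow,
      hc, sub_mul]
    congr 1
    have := (hlogm n).ne'
    field_simp
  have hsmall : ∀ n : ℕ, 3 * Real.log n / (2 * Real.log (m n)) < 1 / 2 →
      dOf (3 * Real.log n / (2 * Real.log (m n))) * Real.log (m n) = 1 / 2 * Real.log (m n) ∧
        3 / 2 * Real.log n - Real.log (a n) = 3 / 2 * Real.log n := fun n h => by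
    rw [ha]
    simp only
    rw [floor_curly, dOf, if_pos h, if_pos h]
    simp
  have hmain : Tendsto (fun n : ℕ => ((3 / 2 * Real.log n - Real.log (a n) : ℝ) : EReal))
      atTop (nhds L) := by
    by_cases hlt : ∀ᶠ n : ℕ in atTop, 1 / 2 ≤ 3 * Real.log n / (2 * Real.log (m n))
    · refine hL.congr' ?_
      filter_upwards [hlt] with n hn
      rw [hlarge n hn]
    · have hfreq : ∃ᶠ n : ℕ in atTop, 3 * Real.log n / (2 * Real.log (m n)) < 1 / 2 := by
        simpa [Filter.Frequently, not_lt] using hlt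
      have hlogm_top : Tendsto (fun n => 1 / 2 * Real.log (m n)) atTop atTop :=
        (Real.tendsto_log_atTop.comp (tendsto_natCast_atTop_atTop.comp hm')).const_mul_atTop
          (by norm_num)
      have hlogn_top : Tendsto (fun n : ℕ => 3 / 2 * Real.log n) atTop atTop :=
        (Real.tendsto_log_atTop.comp tendsto_natCast_atTop_atTop).const_mul_atTop (by norm_num)
      obtain rfl : L = ⊤ := by
        by_contra hne
        obtain ⟨x, hLx, -⟩ := EReal.lt_iff_exists_real_btwn.1 (lt_top_iff_ne_top.2 hne)
        obtain ⟨n, h1, h2, h3⟩ := (hfreq.and_eventually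
          ((hL.eventually (gt_mem_nhds hLx)).and (hlogm_top.eventually_ge_atTop x))).exists
        rw [(hsmall n h1).1, EReal.coe_lt_coe_iff] at h2
        linarith
      rw [EReal.tendsto_coe_nhds_top_iff] at hL ⊢
      refine tendsto_atTop.2 fun x => ?_
      filter_upwards [hL.eventually_ge_atTop x, hlogn_top.eventually_ge_atTop x] with n h1 h2
      rcases lt_or_ge (3 * Real.log n / (2 * Real.log (m n))) (1 / 2) with h | h
      · rwa [(hsmall n h).2]
      · rwa [← hlarge n h]
  refine (tendsto_tv_Qs ha0 hmain).congr' ?_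
  filter_upwards [eventually_ne_atTop 0] with n hn
  obtain ⟨k, rfl⟩ := Nat.exists_eq_succ_of_ne_zero hn
  rw [iterConv_Qs]
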